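/- Let P = ∏_{p prime} 𝔽_p be the direct product over all prime numbers p of the prime fields 𝔽_p = ZMod p, equipped with the pointwise inverse operation, and let A be the smallest subring of P that is closed under this inverse operation. Then every element of P with finite support (i.e. every element whose coordinate is 0 at all but finitely many primes) belongs to A, and the set I of all finitely supported elements of P is an ideal of the ring A; moreover I equals the ideal of A generated by the elements Z_p (where Z_p is 1 at coordinate p and 0 at all other coordinates). -/

import Mathlib

/-- The index type of all prime numbers. -/
abbrev Primes : Type := {p : ℕ // Nat.Prime p}

/-- `P` is the direct product over all primes `p` of the prime fields `ZMod p`. -/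
abbrev P : Type := ∀ p : Primes, ZMod p.1

/-- The pointwise (zero-totalized) inverse operation on `P`. -/
def pinv (x : P) : P := fun p => (x p)⁻¹

/-- `A` is the smallest subring of `P` that is closed under the inverse operation. -/
def A : Subring P := sInf {S : Subring P | ∀ x ∈ S, pinv x ∈ S}

/-- `Zp p` is the element of `P` that is `1` at coordinate `p` and `0` elsewhere. -/
def Zp (p : Primes) : P := fun q => if q = p then 1 else 0

lemma pinv_mem_A {x : P} (hx : x ∈ A) : pinv x ∈ A :=
  Subring.mem_sInf.2 fun S hS => hS x (Subring.mem_sInf.1 hx S hS)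

lemma Zp_eq_one_sub (p : Primes) : Zp p = 1 - (p.1 : P) * pinv (p.1 : P) := by
  funext q
  simp only [Zp, pinv, Pi.sub_apply, Pi.one_apply, Pi.mul_apply, Pi.natCast_apply]
  split_ifs with h
  · subst h
    simp
  · have hpq : Nat.Coprime p.1 q.1 :=
      (Nat.coprime_primes p.2 q.2).2 fun e => h (Subtype.ext e.symm)
    rw [ZMod.coe_mul_inv_eq_one p.1 hpq, sub_self]

lemma Zp_mem_A (p : Primes) : Zp p ∈ A := by
  rw [Zp_eq_one_sub]
  exact A.sub_mem A.one_mem (A.mul_mem (natCast_mem A p.1) (pinv_mem_A (natCast_mem A p.1)))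

lemma eq_sum_natCast_mul_Zp {x : P} (hx : {q : Primes | x q ≠ 0}.Finite) :
    x = ∑ q ∈ hx.toFinset, ((x q).val : P) * Zp q := by
  funext r
  have : NeZero r.1 := ⟨r.2.ne_zero⟩
  simp only [Finset.sum_apply, Pi.mul_apply, Pi.natCast_apply, Zp, mul_ite, mul_one, mul_zero,
    Finset.sum_ite_eq, Set.Finite.mem_toFinset, Set.mem_ofPred_eq]
  split_ifs with h
  · exact (ZMod.natCast_zmod_val (x r)).symm
  · exact not_not.1 h

lemma mem_A_of_finite_support {x : P} (hx : {q : Primes | x q ≠ 0}.Finite) : x ∈ A := by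
  rw [eq_sum_natCast_mul_Zp hx]
  exact A.sum_mem fun q _ => A.mul_mem (natCast_mem A _) (Zp_mem_A q)

/-- The ideal of finitely supported elements of `A`. -/
def finSupportIdeal : Ideal A where
  carrier := {a | {q : Primes | (a : P) q ≠ 0}.Finite}
  zero_mem' := by simp
  add_mem' {a b} ha hb := (ha.union hb).subset fun q hq => by
    by_contra h
    simp only [Set.mem_union, Set.mem_ofPred_eq, not_or, not_not] at h
    exact hq (by simp [h.1, h.2])
  smul_mem' c a ha := ha.subset fun q hq h => hq (by simp [h])

lemma finSupportIdeal_eq_span :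
    finSupportIdeal = Ideal.span {a : A | ∃ p : Primes, (a : P) = Zp p} := by
  apply le_antisymm
  · intro a ha
    have hsum : a = ∑ q ∈ Set.Finite.toFinset ha,
        (((a : P) q).val : A) * (⟨Zp q, Zp_mem_A q⟩ : A) := by
      apply Subtype.ext
      push_cast
      exact eq_sum_natCast_mul_Zp ha
    rw [hsum]
    exact Ideal.sum_mem _ fun q _ => Ideal.mul_mem_left _ _ (Ideal.subset_span ⟨q, rfl⟩)
  · rw [Ideal.span_le]
    rintro a ⟨p, hp⟩
    refine (Set.finite_singleton p).subset fun q hq => ?_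
    by_contra h
    exact hq (by rw [hp]; exact if_neg h)

/-- every finitely supported element of `P` belongs to `A`; the set of
finitely supported elements is an ideal `I` of the ring `A`; and `I` is the ideal of
`A` generated by the elements `Zp p`. -/
theorem finsupport_ideal :
    (∀ x : P, {q : Primes | x q ≠ 0}.Finite → x ∈ A) ∧
    ∃ I : Ideal A,
      (∀ a : A, a ∈ I ↔ {q : Primes | (a : P) q ≠ 0}.Finite) ∧
      I = Ideal.span {a : A | ∃ p : Primes, (a : P) = Zp p} :=
  ⟨fun _ => mem_A_of_finite_support, finSupportIdeal, fun _ => Iff.rfl, finSupportIdeal_eq_span⟩
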